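/- Let u be a prime power, m ≥ 6 an even integer, and S = PSp_{2m}(u). Suppose s1 and s2 are distinct primes dividing |S| such that s1·s2 ∉ ω(S) and there is no prime r dividing |S| with both r·s1 ∈ ω(S) and r·s2 ∈ ω(S). Then, possibly after swapping s1 and s2, the multiplicative order of u modulo s1 equals 2m; and if moreover m ≡ 2 (mod 4), then the multiplicative order of u modulo s2 equals m−1 or 2(m−1). -/

import Mathlib

/-- The spectrum of a group `G`: the set of element orders of `G`. -/
def elementOrders (G : Type*) [Monoid G] : Set ℕ := {n | ∃ g : G, orderOf g = n}

/-- `PSL n F`: the projective special linear group over `F`,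
i.e. the quotient of `SL_n(F)` by its center. -/
abbrev PSL (n : ℕ) (F : Type*) [Field F] :=
  Matrix.SpecialLinearGroup (Fin n) F ⧸
    Subgroup.center (Matrix.SpecialLinearGroup (Fin n) F)

/-- `PSp n F`: the projective symplectic group, i.e. the quotient of the
symplectic group `Sp_{2n}(F)` (2n×2n matrices preserving the standard symplectic
form) by its center. -/
abbrev PSp (n : ℕ) (F : Type*) [Field F] :=
  Matrix.symplecticGroup (Fin n) F ⧸
    Subgroup.center (Matrix.symplecticGroup (Fin n) F)

/-- `G` is an almost simple group with socle isomorphic to `L`: there is an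
injective homomorphism `ι : G → Aut L` whose image contains the inner
automorphisms `Inn L`. -/
def IsAlmostSimpleWithSocle (G : Type*) [Group G] (L : Type*) [Group L] : Prop :=
  ∃ ι : G →* MulAut L, Function.Injective ι ∧ (MulAut.conj (G := L)).range ≤ ι.range

section FieldEmbedding

open Matrix

theorem traceMatrix_transpose {F K ι : Type*} [Field F] [Field K] [Algebra F K]
    (b : Module.Basis ι F K) :
    (Algebra.traceMatrix F b)ᵀ = Algebra.traceMatrix F b := by
  ext i j
  simp [Algebra.traceMatrix_apply, Algebra.traceForm_apply, mul_comm]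

variable {F K ι : Type*} [Field F] [Field K] [Algebra F K] [Fintype ι] [DecidableEq ι]

theorem isUnit_det_traceMatrix [FiniteDimensional F K] [Algebra.IsSeparable F K]
    (b : Module.Basis ι F K) : IsUnit (Algebra.traceMatrix F b).det := by
  rw [Algebra.traceMatrix_of_basis]
  exact (LinearMap.BilinForm.nondegenerate_iff_det_ne_zero b).1 (traceForm_nondegenerate F K)
    |>.isUnit

theorem leftMulMatrix_transpose_mul_traceMatrix (b : Module.Basis ι F K) (a : K) :
    (Algebra.leftMulMatrix b a)ᵀ * Algebra.traceMatrix F b =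
      Algebra.traceMatrix F b * Algebra.leftMulMatrix b a := by
  have key : ∀ i j, (Algebra.traceMatrix F b * Algebra.leftMulMatrix b a) i j =
      Algebra.trace F K (b i * (a * b j)) := by
    intro i j
    simp only [Matrix.mul_apply, Algebra.traceMatrix_apply, Algebra.traceForm_apply,
      Algebra.leftMulMatrix_eq_repr_mul]
    conv_rhs => rw [← b.sum_repr (a * b j)]
    simp only [Finset.mul_sum, map_sum, mul_smul_comm, map_smul, smul_eq_mul, mul_comm]
  ext i j
  rw [key]
  have := key j i
  rw [← Matrix.transpose_apply (_ * _), Matrix.transpose_mul, traceMatrix_transpose] at this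
  rw [this]
  congr 1
  ring

/-- Restriction of scalars for `2 × 2` matrices, in a basis of `K²` whose second half is dual to
its first half with respect to the trace form. -/
noncomputable def restrictScalarsTwo [FiniteDimensional F K] [Algebra.IsSeparable F K]
    (b : Module.Basis ι F K) :
    Matrix (Fin 2) (Fin 2) K →* Matrix (ι ⊕ ι) (ι ⊕ ι) F where
  toFun N := fromBlocks (Algebra.leftMulMatrix b (N 0 0))
    (Algebra.leftMulMatrix b (N 0 1) * (Algebra.traceMatrix F b)⁻¹)
    (Algebra.traceMatrix F b * Algebra.leftMulMatrix b (N 1 0))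
    (Algebra.traceMatrix F b * Algebra.leftMulMatrix b (N 1 1) * (Algebra.traceMatrix F b)⁻¹)
  map_one' := by
    simp [Matrix.mul_nonsing_inv _ (isUnit_det_traceMatrix b)]
  map_mul' N P := by
    have h := Matrix.nonsing_inv_mul _ (isUnit_det_traceMatrix b)
    have h' : ∀ X, (Algebra.traceMatrix F b)⁻¹ * (Algebra.traceMatrix F b * X) = X := fun X => by
      rw [← Matrix.mul_assoc, h, Matrix.one_mul]
    simp only [fromBlocks_multiply, Matrix.mul_apply, Fin.sum_univ_two, map_add, map_mul,
      Matrix.mul_assoc, h', Matrix.mul_add, Matrix.add_mul]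

theorem restrictScalarsTwo_injective [FiniteDimensional F K] [Algebra.IsSeparable F K]
    (b : Module.Basis ι F K) : Function.Injective (restrictScalarsTwo b) := by
  intro N P h
  have hu := isUnit_det_traceMatrix b
  have hu' : IsUnit (Algebra.traceMatrix F b) := (Matrix.isUnit_iff_isUnit_det _).2 hu
  have hv' : IsUnit (Algebra.traceMatrix F b)⁻¹ := (Matrix.isUnit_nonsing_inv_iff).2 hu'
  simp only [restrictScalarsTwo, MonoidHom.coe_mk, OneHom.coe_mk, fromBlocks_inj,
    hu'.mul_right_inj, hv'.mul_left_inj, (Algebra.leftMulMatrix_injective b).eq_iff] at h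
  ext i j
  fin_cases i <;> fin_cases j <;> simp [h]

theorem restrictScalarsTwo_mem [FiniteDimensional F K] [Algebra.IsSeparable F K]
    (b : Module.Basis ι F K) {N : Matrix (Fin 2) (Fin 2) K} (hN : N.det = 1) :
    restrictScalarsTwo b N ∈ symplecticGroup ι F := by
  have hu := isUnit_det_traceMatrix b
  have h1 := Matrix.nonsing_inv_mul _ hu
  have h2 := Matrix.mul_nonsing_inv _ hu
  have h1' : ∀ X, (Algebra.traceMatrix F b)⁻¹ * (Algebra.traceMatrix F b * X) = X := fun X => by
    rw [← Matrix.mul_assoc, h1, Matrix.one_mul]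
  have ht := leftMulMatrix_transpose_mul_traceMatrix b
  have ht' : ∀ a X, (Algebra.leftMulMatrix b a)ᵀ * (Algebra.traceMatrix F b * X) =
      Algebra.traceMatrix F b * (Algebra.leftMulMatrix b a * X) := fun a X => by
    rw [← Matrix.mul_assoc, ht, Matrix.mul_assoc]
  have hc : ∀ x y, Algebra.leftMulMatrix b x * Algebra.leftMulMatrix b y =
      Algebra.leftMulMatrix b y * Algebra.leftMulMatrix b x := fun x y => by
    rw [← map_mul, ← map_mul, mul_comm]
  have hc' : ∀ x y X, Algebra.leftMulMatrix b x * (Algebra.leftMulMatrix b y * X) =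
      Algebra.leftMulMatrix b y * (Algebra.leftMulMatrix b x * X) := fun x y X => by
    rw [← Matrix.mul_assoc, hc, Matrix.mul_assoc]
  have hdet : Algebra.leftMulMatrix b (N 0 0) * Algebra.leftMulMatrix b (N 1 1) -
      Algebra.leftMulMatrix b (N 0 1) * Algebra.leftMulMatrix b (N 1 0) = 1 := by
    rw [← map_mul, ← map_mul, ← map_sub, ← Matrix.det_fin_two, hN, map_one]
  have e : restrictScalarsTwo b N = fromBlocks (Algebra.leftMulMatrix b (N 0 0))
    (Algebra.leftMulMatrix b (N 0 1) * (Algebra.traceMatrix F b)⁻¹)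
    (Algebra.traceMatrix F b * Algebra.leftMulMatrix b (N 1 0))
    (Algebra.traceMatrix F b * Algebra.leftMulMatrix b (N 1 1) *
      (Algebra.traceMatrix F b)⁻¹) := rfl
  rw [e, SymplecticGroup.fromBlocks_mem_iff]
  simp only [Matrix.transpose_mul, Matrix.transpose_nonsing_inv, traceMatrix_transpose,
    Matrix.mul_assoc, ht', ht]
  refine ⟨?_, ?_, ?_⟩
  · rw [hc]
  · simp only [h1']
    rw [hc']
  · rw [hc' (N 1 0) (N 0 1), ← Matrix.mul_sub, ← Matrix.mul_assoc, ← Matrix.mul_assoc,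
      ← Matrix.sub_mul, hdet, Matrix.one_mul, h2]

end FieldEmbedding

section Tori

open Matrix

variable {F : Type*} [Field F] [Finite F]

theorem exists_orderOf_units_eq (K : Type*) [Field K] [Finite K] {d : ℕ}
    (hd : d ∣ Nat.card K - 1) : ∃ x : Kˣ, orderOf x = d := by
  obtain ⟨g, hg⟩ := IsCyclic.exists_ofOrder_eq_natCard (α := Kˣ)
  have : Nat.card Kˣ = Nat.card K - 1 := Nat.card_units K
  refine ⟨g ^ (orderOf g / d), orderOf_pow_orderOf_div (orderOf_pos g).ne' ?_⟩
  rwa [hg, this]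

theorem exists_symplectic_of_two {k : ℕ} (hk : k ≠ 0) {d : ℕ}
    (h : ∀ (K : Type) [Field K] [Finite K], Nat.card K = Nat.card F ^ k →
      ∃ N : Matrix (Fin 2) (Fin 2) K, N.det = 1 ∧ orderOf N = d) :
    ∃ g : symplecticGroup (Fin k) F, orderOf g = d := by
  obtain ⟨p, hp⟩ := CharP.exists F
  have : Fact p.Prime := ⟨CharP.char_is_prime F p⟩
  have : NeZero k := ⟨hk⟩
  obtain ⟨N, hN, hd⟩ := h (FiniteField.Extension F p k) (FiniteField.natCard_extension F p k)
  let b : Module.Basis (Fin k) F (FiniteField.Extension F p k) :=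
    Module.finBasisOfFinrankEq _ _ (FiniteField.finrank_extension F p k)
  refine ⟨⟨restrictScalarsTwo b N, restrictScalarsTwo_mem b hN⟩, ?_⟩
  rw [← orderOf_submonoid, ← hd]
  exact orderOf_injective _ (restrictScalarsTwo_injective b) N

theorem exists_orderOf_symplectic_of_dvd_sub_one {k : ℕ} (hk : k ≠ 0) {d : ℕ}
    (hd : d ∣ Nat.card F ^ k - 1) : ∃ g : symplecticGroup (Fin k) F, orderOf g = d := by
  refine exists_symplectic_of_two hk fun K _ _ hK => ?_
  obtain ⟨x, hx⟩ := exists_orderOf_units_eq K (hK ▸ hd)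
  let f : Kˣ →* Matrix (Fin 2) (Fin 2) K :=
    { toFun := fun a => !![(a : K), 0; 0, ((a⁻¹ : Kˣ) : K)]
      map_one' := by simp [Matrix.one_fin_two]
      map_mul' := fun a b => by simp [mul_comm] }
  refine ⟨f x, by simp [f], ?_⟩
  rw [orderOf_injective f (fun a b h => ?_), hx]
  exact Units.ext (congrFun (congrFun h 0) 0)

theorem exists_orderOf_symplectic_of_dvd_add_one {k : ℕ} (hk : k ≠ 0) {d : ℕ}
    (hd : d ∣ Nat.card F ^ k + 1) : ∃ g : symplecticGroup (Fin k) F, orderOf g = d := by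
  refine exists_symplectic_of_two hk fun K _ _ hK => ?_
  obtain ⟨p, hp⟩ := CharP.exists K
  have : Fact p.Prime := ⟨CharP.char_is_prime K p⟩
  let L := FiniteField.Extension K p 2
  have hL : Nat.card L = Nat.card K ^ 2 := FiniteField.natCard_extension K p 2
  have hf : Nat.card L - 1 = (Nat.card K + 1) * (Nat.card K - 1) := by
    rw [hL, ← Nat.sq_sub_sq, one_pow]
  obtain ⟨x, hx⟩ := exists_orderOf_units_eq L (d := d) (by
    rw [hf, hK]
    exact hd.mul_right _)
  let b : Module.Basis (Fin 2) K L :=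
    Module.finBasisOfFinrankEq _ _ (FiniteField.finrank_extension K p 2)
  refine ⟨Algebra.leftMulMatrix b x, ?_, ?_⟩
  · rw [← Algebra.norm_eq_matrix_det]
    apply (algebraMap K L).injective
    have h1 : 1 < Nat.card K := Finite.one_lt_card
    rw [FiniteField.algebraMap_norm_eq_pow, hf, Nat.mul_div_cancel _ (by omega), map_one,
      ← Units.val_pow_eq_pow_val, orderOf_dvd_iff_pow_eq_one.1 (hx ▸ hK ▸ hd), Units.val_one]
  · rw [← hx, ← orderOf_units]
    exact orderOf_injective (Algebra.leftMulMatrix b).toMonoidHom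
      (Algebra.leftMulMatrix_injective b) _

end Tori

section BlockSum

open Matrix

variable {F α β l : Type*} [Field F] [DecidableEq α] [DecidableEq β] [DecidableEq l]

/-- The permutation of the coordinates that turns an orthogonal sum of two standard symplectic
spaces into a standard symplectic space. -/
def symplecticSumEquiv {α β l : Type*} (e : α ⊕ β ≃ l) : l ⊕ l ≃ (α ⊕ α) ⊕ (β ⊕ β) :=
  (e.sumCongr e).symm.trans (Equiv.sumSumSumComm α β α β)

theorem J_eq_submatrix (e : α ⊕ β ≃ l) :
    J l F = (fromBlocks (J α F) 0 0 (J β F)).submatrix (symplecticSumEquiv e)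
      (symplecticSumEquiv e) := by
  ext i j
  rcases i with i | i <;> rcases j with j | j <;>
  obtain ⟨i, rfl⟩ := e.surjective i <;> obtain ⟨j, rfl⟩ := e.surjective j <;>
  rcases i with i | i <;> rcases j with j | j <;>
  simp [symplecticSumEquiv, J, Matrix.one_apply]

variable [Fintype α] [Fintype β] [Fintype l]

/-- Symplectic matrices of two symplectic spaces act on the orthogonal sum. -/
def symplecticSum (e : α ⊕ β ≃ l) :
    symplecticGroup α F × symplecticGroup β F →* symplecticGroup l F where
  toFun x := ⟨(fromBlocks (x.1 : Matrix _ _ F) 0 0 (x.2 : Matrix _ _ F)).submatrix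
      (symplecticSumEquiv e) (symplecticSumEquiv e), by
    rw [SymplecticGroup.mem_iff, J_eq_submatrix e, transpose_submatrix, submatrix_mul_equiv,
      submatrix_mul_equiv, fromBlocks_transpose, fromBlocks_multiply, fromBlocks_multiply]
    simp [SymplecticGroup.mem_iff.1 x.1.2, SymplecticGroup.mem_iff.1 x.2.2]⟩
  map_one' := by
    apply Subtype.ext
    simp [submatrix_one_equiv]
  map_mul' x y := by
    apply Subtype.ext
    simp [submatrix_mul_equiv, fromBlocks_multiply]

theorem coe_symplecticSum (e : α ⊕ β ≃ l) (x : symplecticGroup α F × symplecticGroup β F) :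
    (symplecticSum e x : Matrix _ _ F) = (fromBlocks (x.1 : Matrix _ _ F) 0 0
      (x.2 : Matrix _ _ F)).submatrix (symplecticSumEquiv e) (symplecticSumEquiv e) := rfl

theorem symplecticSum_injective (e : α ⊕ β ≃ l) :
    Function.Injective (symplecticSum (F := F) e) := by
  intro x y h
  have h' := congrArg (Subtype.val) h
  simp only [coe_symplecticSum] at h'
  have h'' : fromBlocks (x.1 : Matrix _ _ F) 0 0 (x.2 : Matrix _ _ F) =
      fromBlocks (y.1 : Matrix _ _ F) 0 0 (y.2 : Matrix _ _ F) :=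
    (Matrix.reindex (symplecticSumEquiv e).symm (symplecticSumEquiv e).symm).injective
      (by simpa only [reindex_apply, Equiv.symm_symm] using h')
  rw [fromBlocks_inj] at h''
  exact Prod.ext (Subtype.ext h''.1) (Subtype.ext h''.2.2.2)

end BlockSum

section Center

open Matrix

variable {F l : Type*} [Field F] [Fintype l] [DecidableEq l]

theorem upperUnipotent_mem {S : Matrix l l F} (hS : Sᵀ = S) :
    fromBlocks 1 S 0 1 ∈ symplecticGroup l F := by
  simp [SymplecticGroup.fromBlocks_mem_iff, hS]

theorem lowerUnipotent_mem {S : Matrix l l F} (hS : Sᵀ = S) :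
    fromBlocks 1 0 S 1 ∈ symplecticGroup l F := by
  simp [SymplecticGroup.fromBlocks_mem_iff, hS]

theorem exists_eq_smul_one_of_commute_symm [Nonempty l] {A : Matrix l l F}
    (h : ∀ S : Matrix l l F, Sᵀ = S → S * A = A * S) : ∃ c : F, A = c • 1 := by
  have hdiag : ∀ i j, i ≠ j → A i j = 0 := by
    intro i j hij
    have := congrFun (congrFun (h (single i i 1) (by simp)) i) j
    simpa [hij, mul_single_apply_of_ne _ _ _ _ _ (Ne.symm hij)] using this
  have hconst : ∀ i j, A i i = A j j := by
    intro i j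
    by_cases hij : i = j
    · rw [hij]
    have := congrFun (congrFun (h (single i j 1 + single j i 1)
      (by rw [transpose_add]; simp [add_comm])) j) i
    simpa [Matrix.add_mul, Matrix.mul_add, hij, Ne.symm hij] using this
  refine ⟨A (Classical.arbitrary l) (Classical.arbitrary l), ?_⟩
  ext i j
  by_cases hij : i = j
  · subst hij
    simp [hconst i (Classical.arbitrary l)]
  · simp [hij, hdiag]

theorem eq_one_or_neg_one_of_mem_center [Nonempty l] {c : symplecticGroup l F}
    (hc : c ∈ Subgroup.center (symplecticGroup l F)) :
    (c : Matrix (l ⊕ l) (l ⊕ l) F) = 1 ∨ (c : Matrix (l ⊕ l) (l ⊕ l) F) = -1 := by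
  obtain ⟨M, hM⟩ := c
  obtain ⟨A, B, C, D, rfl⟩ : ∃ A B C D, M = fromBlocks A B C D :=
    ⟨_, _, _, _, (fromBlocks_toBlocks M).symm⟩
  rw [Subgroup.mem_center_iff] at hc
  have hup : ∀ S : Matrix l l F, Sᵀ = S → fromBlocks 1 S 0 1 * fromBlocks A B C D =
      fromBlocks A B C D * fromBlocks 1 S 0 1 := fun S hS =>
    congrArg Subtype.val (hc ⟨_, upperUnipotent_mem hS⟩)
  have hlow : ∀ S : Matrix l l F, Sᵀ = S → fromBlocks 1 0 S 1 * fromBlocks A B C D =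
      fromBlocks A B C D * fromBlocks 1 0 S 1 := fun S hS =>
    congrArg Subtype.val (hc ⟨_, lowerUnipotent_mem hS⟩)
  simp only [fromBlocks_multiply, fromBlocks_inj, Matrix.one_mul, Matrix.zero_mul, Matrix.mul_one,
    Matrix.mul_zero, add_zero, zero_add] at hup hlow
  have hC : C = 0 := by simpa using (hup 1 (by simp)).1
  have hD : D = A := by
    have := (hup 1 (by simp)).2.1
    simp only [Matrix.one_mul, Matrix.mul_one] at this
    rw [add_comm] at this
    exact add_right_cancel this
  have hB : B = 0 := by simpa using (hlow 1 (by simp)).1.symm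
  subst hC hD hB
  obtain ⟨c, rfl⟩ := exists_eq_smul_one_of_commute_symm (A := D) fun S hS => by
    simpa using (hup S hS).2.1
  have h1 := (SymplecticGroup.fromBlocks_mem_iff.1 hM).2.2
  have h2 := congrFun (congrFun h1 (Classical.arbitrary l)) (Classical.arbitrary l)
  have h3 : c * c = 1 := by simpa using h2
  rcases mul_self_eq_one_iff.1 h3 with rfl | rfl
  · left; simp
  · right
    rw [← fromBlocks_one, fromBlocks_neg]
    simp

theorem sq_eq_one_of_mem_center [Nonempty l] {c : symplecticGroup l F}
    (hc : c ∈ Subgroup.center (symplecticGroup l F)) : c ^ 2 = 1 := by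
  apply Subtype.ext
  rcases eq_one_or_neg_one_of_mem_center hc with h | h <;> simp [h]

end Center

section Projective

open Matrix

theorem orderOf_mk_eq_mul {G : Type*} [Group G] {N : Subgroup G} [N.Normal] {z : G} {r s : ℕ}
    (hr : r.Prime) (hs : s.Prime) (hz : orderOf z = r * s) (hzr : z ^ r ∉ N) (hzs : z ^ s ∉ N) :
    orderOf (z : G ⧸ N) = r * s := by
  refine orderOf_eq_of_pow_and_pow_div_prime (Nat.mul_pos hr.pos hs.pos) ?_ fun t ht htd => ?_
  · rw [← QuotientGroup.mk_pow, ← hz, pow_orderOf_eq_one, QuotientGroup.mk_one]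
  · rw [← QuotientGroup.mk_pow, Ne, QuotientGroup.eq_one_iff]
    rcases (ht.dvd_mul).1 htd with h | h
    · rw [(Nat.prime_dvd_prime_iff_eq ht hr).1 h, Nat.mul_div_cancel_left _ hr.pos]
      exact hzs
    · rw [(Nat.prime_dvd_prime_iff_eq ht hs).1 h, Nat.mul_div_cancel _ hs.pos]
      exact hzr

variable {F : Type*} [Field F]

theorem symplecticSum_mem_center {α β l : Type*} [Fintype α] [DecidableEq α] [Fintype β]
    [DecidableEq β] [Fintype l] [DecidableEq l] [Nonempty α] [Nonempty β] (e : α ⊕ β ≃ l)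
    {x : symplecticGroup α F × symplecticGroup β F}
    (hx : symplecticSum e x ∈ Subgroup.center (symplecticGroup l F)) :
    ((x.1 : Matrix (α ⊕ α) (α ⊕ α) F) = 1 ∧ (x.2 : Matrix (β ⊕ β) (β ⊕ β) F) = 1) ∨
      ((x.1 : Matrix (α ⊕ α) (α ⊕ α) F) = -1 ∧ (x.2 : Matrix (β ⊕ β) (β ⊕ β) F) = -1) := by
  have : Nonempty l := ⟨e (Sum.inl (Classical.arbitrary α))⟩
  rcases eq_one_or_neg_one_of_mem_center hx with h | h
  · left
    have h' : symplecticSum e x = symplecticSum e 1 := by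
      rw [map_one]
      exact Subtype.ext h
    rw [symplecticSum_injective e h']
    simp
  · right
    have h' : symplecticSum e x = symplecticSum e
        (⟨-1, SymplecticGroup.neg_mem (one_mem _)⟩, ⟨-1, SymplecticGroup.neg_mem (one_mem _)⟩) := by
      apply Subtype.ext
      rw [h, coe_symplecticSum]
      have : fromBlocks (-1 : Matrix (α ⊕ α) (α ⊕ α) F) 0 0 (-1 : Matrix (β ⊕ β) (β ⊕ β) F) = -1 := by
        rw [← fromBlocks_one (l := α ⊕ α) (m := β ⊕ β), fromBlocks_neg, neg_zero, neg_zero]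
      simp only [this]
      rw [submatrix_neg]
      simp [submatrix_one_equiv]
    rw [symplecticSum_injective e h']
    simp

theorem exists_orderOf_symplectic_mono {a b : ℕ} (hab : a ≤ b) {d : ℕ}
    (h : ∃ g : symplecticGroup (Fin a) F, orderOf g = d) :
    ∃ g : symplecticGroup (Fin b) F, orderOf g = d := by
  obtain ⟨c, rfl⟩ := Nat.exists_eq_add_of_le hab
  obtain ⟨g, rfl⟩ := h
  refine ⟨symplecticSum finSumFinEquiv (g, 1), ?_⟩
  rw [orderOf_injective _ (symplecticSum_injective _), Prod.orderOf_mk, orderOf_one,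
    Nat.lcm_one_right]

theorem mul_mem_elementOrders_of_add {a b m : ℕ} (ha : a ≠ 0) (hb : b ≠ 0) (hm : a + b = m)
    {r s : ℕ} (hr : r.Prime) (hs : s.Prime) (hrs : r ≠ s)
    (hx : ∃ x : symplecticGroup (Fin a) F, orderOf x = r)
    (hy : ∃ y : symplecticGroup (Fin b) F, orderOf y = s) :
    r * s ∈ elementOrders (PSp m F) := by
  subst hm
  have : NeZero a := ⟨ha⟩
  have : NeZero b := ⟨hb⟩
  obtain ⟨x, rfl⟩ := hx
  obtain ⟨y, rfl⟩ := hy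
  have hco := (Nat.coprime_primes hr hs).2 hrs
  have hx1 : x ^ orderOf y ≠ 1 := fun h =>
    hrs ((Nat.prime_dvd_prime_iff_eq hr hs).1 (orderOf_dvd_of_pow_eq_one h))
  have hy1 : y ^ orderOf x ≠ 1 := fun h =>
    hrs ((Nat.prime_dvd_prime_iff_eq hs hr).1 (orderOf_dvd_of_pow_eq_one h)).symm
  refine ⟨QuotientGroup.mk (symplecticSum finSumFinEquiv (x, y)), orderOf_mk_eq_mul hr hs ?_ ?_ ?_⟩
  · rw [orderOf_injective _ (symplecticSum_injective _), Prod.orderOf_mk, hco.lcm_eq_mul]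
  · rw [← map_pow, Prod.pow_mk, pow_orderOf_eq_one]
    intro h
    rcases symplecticSum_mem_center _ h with h | h
    · exact hy1 (Subtype.ext h.2)
    · refine hy1 (Subtype.ext ?_)
      have := congrFun (congrFun h.1 (Sum.inl 0)) (Sum.inl 0)
      have h1 : (1 : F) = -1 := by simpa using this
      have h2 := h.2
      rw [← neg_one_smul F, ← h1, one_smul] at h2
      exact h2
  · rw [← map_pow, Prod.pow_mk, pow_orderOf_eq_one]
    intro h
    rcases symplecticSum_mem_center _ h with h | h
    · exact hx1 (Subtype.ext h.1)
    · refine hx1 (Subtype.ext ?_)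
      have := congrFun (congrFun h.2 (Sum.inl 0)) (Sum.inl 0)
      have h1 : (1 : F) = -1 := by simpa using this
      have h2 := h.1
      rw [← neg_one_smul F, ← h1, one_smul] at h2
      exact h2

theorem mul_mem_elementOrders_of_odd {m : ℕ} (hm : m ≠ 0) {r s : ℕ} (hr : r.Prime) (hs : s.Prime)
    (hr2 : r ≠ 2) (hs2 : s ≠ 2) (h : ∃ x : symplecticGroup (Fin m) F, orderOf x = r * s) :
    r * s ∈ elementOrders (PSp m F) := by
  have : NeZero m := ⟨hm⟩
  obtain ⟨x, hx⟩ := h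
  refine ⟨QuotientGroup.mk x, orderOf_mk_eq_mul hr hs hx (fun h => ?_) fun h => ?_⟩
  · have h' := orderOf_dvd_of_pow_eq_one (sq_eq_one_of_mem_center h)
    rw [orderOf_pow_of_dvd hr.ne_zero (hx ▸ dvd_mul_right r s), hx,
      Nat.mul_div_cancel_left _ hr.pos] at h'
    exact hs2 ((Nat.prime_dvd_prime_iff_eq hs Nat.prime_two).1 h')
  · have h' := orderOf_dvd_of_pow_eq_one (sq_eq_one_of_mem_center h)
    rw [orderOf_pow_of_dvd hs.ne_zero (hx ▸ dvd_mul_left s r), hx,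
      Nat.mul_div_cancel _ hs.pos] at h'
    exact hr2 ((Nat.prime_dvd_prime_iff_eq hr Nat.prime_two).1 h')

theorem exists_orderOf_symplectic_eq_char {l : ℕ} (hl : l ≠ 0) (p : ℕ) [Fact p.Prime] [CharP F p] :
    ∃ g : symplecticGroup (Fin l) F, orderOf g = p := by
  have : NeZero l := ⟨hl⟩
  refine ⟨⟨fromBlocks 1 1 0 1, upperUnipotent_mem (by simp)⟩, orderOf_eq_prime ?_ ?_⟩
  · apply Subtype.ext
    have key : ∀ n : ℕ, (fromBlocks 1 1 0 1 : Matrix (Fin l ⊕ Fin l) (Fin l ⊕ Fin l) F) ^ n =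
        fromBlocks 1 ((n : F) • 1) 0 1 := by
      intro n
      induction n with
      | zero => simp
      | succ n ih => simp [pow_succ, ih, fromBlocks_multiply, add_smul, add_comm]
    simp [key]
  · intro h
    have := congrFun (congrFun (congrArg Subtype.val h) (Sum.inl 0)) (Sum.inr 0)
    simp at this

end Projective

section Eigenvalues

open Matrix

variable {F l : Type*} [Field F] [Fintype l] [DecidableEq l]

theorem SymplecticGroup.charpoly_inv {R : Type*} [CommRing R] {M : Matrix (l ⊕ l) (l ⊕ l) R}
    (hM : M ∈ symplecticGroup l R) : M⁻¹.charpoly = M.charpoly := by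
  rw [SymplecticGroup.inv_eq_symplectic_inv _ hM, Matrix.mul_assoc, Matrix.charpoly_mul_comm,
    Matrix.mul_assoc, Matrix.mul_neg, J_squared, neg_neg, Matrix.mul_one, Matrix.charpoly_transpose]

theorem SymplecticGroup.isRoot_charpoly_inv {M : Matrix (l ⊕ l) (l ⊕ l) F}
    (hM : M ∈ symplecticGroup l F) {x : F} (hx : M.charpoly.IsRoot x) :
    M.charpoly.IsRoot x⁻¹ := by
  have hu : IsUnit M := (Matrix.isUnit_iff_isUnit_det _).2 (SymplecticGroup.symplectic_det hM)
  rw [← mem_spectrum_iff_isRoot_charpoly] at hx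
  rw [← charpoly_inv hM, ← mem_spectrum_iff_isRoot_charpoly]
  simpa [Matrix.coe_units_inv] using
    (spectrum.inv₀_mem_inv_iff (r := x) (a := hu.unit)).2 hx

theorem exists_root_charpoly_of_pow_eq_one [IsAlgClosed F] {n : Type*} [Fintype n] [DecidableEq n]
    {M : Matrix n n F} {s : ℕ} (hs : (s : F) ≠ 0) (h : M ^ s = 1) (h1 : M ≠ 1) :
    ∃ x : F, M.charpoly.IsRoot x ∧ x ^ s = 1 ∧ x ≠ 1 := by
  have hn : Nonempty n := by
    by_contra hn
    rw [not_nonempty_iff] at hn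
    exact h1 (Subsingleton.elim _ _)
  have hgeom : (∑ i ∈ Finset.range s, M ^ i) * (M - 1) = 0 := by
    rw [geom_sum_mul, h, sub_self]
  have hnu : ¬ IsUnit (∑ i ∈ Finset.range s, M ^ i) := fun hu =>
    h1 (sub_eq_zero.1 (hu.mul_right_eq_zero.1 hgeom))
  have hmem : (0 : F) ∈ spectrum F (Polynomial.aeval M
      (∑ i ∈ Finset.range s, (Polynomial.X : Polynomial F) ^ i)) := by
    rw [spectrum.zero_mem_iff]
    simpa using hnu
  rw [spectrum.map_polynomial_aeval_of_nonempty _ _ (spectrum.nonempty_of_isAlgClosed_of_finiteDimensional F M)] at hmem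
  obtain ⟨x, hx, hx0⟩ := hmem
  simp only [Polynomial.eval_finsetSum, Polynomial.eval_pow, Polynomial.eval_X] at hx0
  refine ⟨x, mem_spectrum_iff_isRoot_charpoly.1 hx, ?_, ?_⟩
  · rw [← sub_eq_zero, ← geom_sum_mul, hx0, zero_mul]
  · rintro rfl
    simp at hx0
    exact hs hx0

theorem SymplecticGroup.natCard_closure_le {F : Type*} [Field F] [Finite F] {m s : ℕ} [Fact s.Prime] (hsF : (s : F) ≠ 0)
    (hs : s ∣ Nat.card (symplecticGroup (Fin m) F)) (q : (ZMod s)ˣ)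
    (hq : (q : ZMod s) = (Nat.card F : ZMod s)) :
    Nat.card (Subgroup.closure {q, -1}) ≤ 2 * m := by
  classical
  have hs0 : s ≠ 0 := (Fact.out : s.Prime).ne_zero
  obtain ⟨g, hg⟩ := exists_prime_orderOf_dvd_card' s hs
  let Ω := AlgebraicClosure F
  let M : Matrix (Fin m ⊕ Fin m) (Fin m ⊕ Fin m) Ω := (g : Matrix _ _ F).map (algebraMap F Ω)
  have hMs : M ∈ symplecticGroup (Fin m) Ω := SymplecticGroup.map_mem g.2 _
  have hM : M = (algebraMap F Ω).mapMatrix (g : Matrix _ _ F) := rfl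
  have hMpow : M ^ s = 1 := by
    rw [hM, ← map_pow, ← SubmonoidClass.coe_pow, ← hg, pow_orderOf_eq_one, OneMemClass.coe_one,
      map_one]
  have hM1 : M ≠ 1 := by
    intro h
    rw [hM, ← map_one (algebraMap F Ω).mapMatrix] at h
    have h' := (Matrix.map_injective (algebraMap F Ω).injective) h
    have : g = 1 := Subtype.ext h'
    rw [this, orderOf_one] at hg
    exact (Fact.out : s.Prime).one_lt.ne hg
  have hsΩ : (s : Ω) ≠ 0 := by
    rw [← map_natCast (algebraMap F Ω)]
    exact (map_ne_zero _).2 hsF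
  obtain ⟨x, hx, hxs, hx1⟩ := exists_root_charpoly_of_pow_eq_one hsΩ hMpow hM1
  have hord : orderOf x = s := orderOf_eq_prime hxs hx1
  have hfrob : ∀ y : Ω, M.charpoly.IsRoot y → M.charpoly.IsRoot (y ^ Nat.card F) := by
    intro y hy
    have := Fintype.ofFinite F
    rw [hM, RingHom.mapMatrix_apply, charpoly_map, Polynomial.IsRoot, Polynomial.eval_map_algebraMap] at hy ⊢
    have h := Polynomial.aeval_algHom_apply (FiniteField.frobeniusAlgHom F Ω) y
      (g : Matrix (Fin m ⊕ Fin m) (Fin m ⊕ Fin m) F).charpoly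
    rw [hy, map_zero] at h
    simpa [Nat.card_eq_fintype_card] using h
  have key : ∀ j ∈ Subgroup.closure {q, -1}, ∀ y : Ω, y ^ s = 1 → M.charpoly.IsRoot y →
      M.charpoly.IsRoot (y ^ (j : ZMod s).val) := by
    intro j hj
    rw [← Subgroup.mem_toSubmonoid, Subgroup.closure_toSubmonoid_of_finite] at hj
    induction hj using Submonoid.closure_induction with
    | mem j hj =>
      intro y hys hy
      have hmod : ∀ a b : ℕ, (a : ZMod s) = b → y ^ a = y ^ b := fun a b hab =>
        pow_eq_pow_of_modEq ((ZMod.natCast_eq_natCast_iff _ _ _).1 hab) hys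
      rcases hj with rfl | hj
      · rw [hmod _ (Nat.card F) (by simp [hq])]
        exact hfrob y hy
      · rw [Set.mem_singleton_iff] at hj
        subst hj
        have hy' : y ^ (s - 1) = y⁻¹ := by
          rw [← mul_eq_one_iff_eq_inv₀ (by rintro rfl; simp [hs0] at hys), ← pow_succ,
            Nat.sub_add_cancel (Nat.pos_of_ne_zero hs0), hys]
        rw [hmod _ (s - 1) (by simp [Nat.cast_sub (Fact.out : s.Prime).one_le]), hy']
        exact SymplecticGroup.isRoot_charpoly_inv hMs hy
    | one =>
      intro y hys hy
      have : Fact (1 < s) := ⟨(Fact.out : s.Prime).one_lt⟩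
      simpa [ZMod.val_one] using hy
    | mul j k _ _ hj hk =>
      intro y hys hy
      have hjk := hk _ (by rw [← pow_mul, mul_comm, pow_mul, hys, one_pow]) (hj y hys hy)
      rw [← pow_mul] at hjk
      convert! hjk using 1
      refine pow_eq_pow_of_modEq ((ZMod.natCast_eq_natCast_iff _ _ _).1 ?_) hys
      simp
  have hne : M.charpoly ≠ 0 := (charpoly_monic M).ne_zero
  let f : Subgroup.closure {q, -1} → M.charpoly.roots.toFinset := fun j =>
    ⟨x ^ ((j : (ZMod s)ˣ) : ZMod s).val, by
      rw [Multiset.mem_toFinset, Polynomial.mem_roots hne]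
      exact key j j.2 x hxs hx⟩
  have hf : Function.Injective f := by
    intro i j hij
    have h1 := congrArg Subtype.val hij
    have h2 := pow_injOn_Iio_orderOf (x := x) (by simp [hord, ZMod.val_lt]) (by simp [hord, ZMod.val_lt]) h1
    exact Subtype.ext (Units.ext (ZMod.val_injective _ h2))
  calc Nat.card (Subgroup.closure {q, -1})
      ≤ Nat.card M.charpoly.roots.toFinset := Nat.card_le_card_of_injective f hf
    _ = M.charpoly.roots.toFinset.card :=
      Nat.card_eq_fintype_card.trans (Fintype.card_coe _)
    _ ≤ M.charpoly.roots.card := Multiset.toFinset_card_le _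
    _ ≤ M.charpoly.natDegree := Polynomial.card_roots' _
    _ = 2 * m := by simp [charpoly_natDegree_eq_dim, two_mul]

theorem orderOf_natCard_le {F : Type*} [Field F] [Finite F] {m s : ℕ} (hs : s.Prime)
    (hsF : (s : F) ≠ 0) (hd : s ∣ Nat.card (symplecticGroup (Fin m) F))
    (hq : (Nat.card F : ZMod s) ≠ 0) :
    orderOf (Nat.card F : ZMod s) ≤ 2 * m ∧
      (Odd (orderOf (Nat.card F : ZMod s)) → orderOf (Nat.card F : ZMod s) ≤ m) := by
  have : Fact s.Prime := ⟨hs⟩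
  let q : (ZMod s)ˣ := Units.mk0 _ hq
  have hle := SymplecticGroup.natCard_closure_le hsF hd q rfl
  have hoq : orderOf (Nat.card F : ZMod s) = orderOf q := by
    rw [← orderOf_units]
    rfl
  have hpos : 0 < Nat.card (Subgroup.closure {q, -1}) := Nat.card_pos
  have hdq : orderOf q ∣ Nat.card (Subgroup.closure {q, -1}) :=
    Subgroup.orderOf_dvd_natCard _ (Subgroup.subset_closure (by simp))
  rw [hoq]
  refine ⟨(Nat.le_of_dvd hpos hdq).trans hle, fun hodd => ?_⟩
  rcases hs.eq_two_or_odd' with rfl | hs2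
  · have : orderOf q = 1 := by
      rw [orderOf_eq_one_iff]
      exact Subsingleton.elim _ _
    omega
  · have hd2 : 2 ∣ Nat.card (Subgroup.closure {q, -1}) := by
      have h : orderOf (-1 : (ZMod s)ˣ) = 2 := by
        refine orderOf_eq_prime (by simp) fun h => ?_
        have : Fact (2 < s) := ⟨by
          have := hs.two_le
          rcases hs2 with ⟨k, rfl⟩
          omega⟩
        exact ZMod.neg_one_ne_one (congrArg Units.val h)
      rw [← h]
      exact Subgroup.orderOf_dvd_natCard _ (Subgroup.subset_closure (by simp))
    have hco : Nat.Coprime 2 (orderOf q) := Nat.coprime_two_left.2 hodd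
    have := Nat.le_of_dvd hpos (hco.mul_dvd_of_dvd_of_dvd hd2 hdq)
    omega

end Eigenvalues

section PrimeGraph

open Matrix

variable {F : Type*} [Field F] [Finite F]

theorem exists_orderOf_symplectic_of_orderOf_dvd {s k : ℕ} (hs : s.Prime) (hk : k ≠ 0)
    (h : orderOf (Nat.card F : ZMod s) ∣ 2 * k) :
    ∃ g : symplecticGroup (Fin k) F, orderOf g = s := by
  have : Fact s.Prime := ⟨hs⟩
  have h1 := orderOf_dvd_iff_pow_eq_one.1 h
  rw [mul_comm, pow_mul, pow_two, mul_self_eq_one_iff] at h1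
  rcases h1 with h1 | h1
  · apply exists_orderOf_symplectic_of_dvd_sub_one hk
    rw [← ZMod.natCast_eq_zero_iff, Nat.cast_sub (Nat.one_le_pow _ _ Nat.card_pos)]
    simp [h1]
  · apply exists_orderOf_symplectic_of_dvd_add_one hk
    rw [← ZMod.natCast_eq_zero_iff]
    simp [h1]

theorem natCast_natCard_ne_zero {p s : ℕ} [Fact p.Prime] [CharP F p] (hs : s.Prime) (h : s ≠ p) :
    (Nat.card F : ZMod s) ≠ 0 := by
  have := Fintype.ofFinite F
  obtain ⟨n, hp, hn⟩ := FiniteField.card F p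
  rw [Nat.card_eq_fintype_card, hn, Ne, ZMod.natCast_eq_zero_iff]
  exact fun hd => h ((Nat.prime_dvd_prime_iff_eq hs hp).1 (hs.dvd_of_dvd_pow hd))

theorem exists_orderOf_symplectic_of_dvd_natCard {p s m : ℕ} [hp : Fact p.Prime] [CharP F p]
    (hs : s.Prime) (h : s ≠ p) (hd : s ∣ Nat.card (PSp m F)) :
    ∃ k, k ≠ 0 ∧ k ≤ m ∧ (k = orderOf (Nat.card F : ZMod s) ∧ Odd k ∨
      2 * k = orderOf (Nat.card F : ZMod s)) ∧
      ∃ g : symplecticGroup (Fin k) F, orderOf g = s := by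
  have : Fact s.Prime := ⟨hs⟩
  have hq := natCast_natCard_ne_zero (F := F) (p := p) hs h
  have hsF : (s : F) ≠ 0 := by
    rw [Ne, CharP.cast_eq_zero_iff F p]
    exact fun hd => h ((Nat.prime_dvd_prime_iff_eq hp.out hs).1 hd).symm
  have hd' : s ∣ Nat.card (symplecticGroup (Fin m) F) := hd.trans (Subgroup.card_quotient_dvd_card _)
  obtain ⟨h1, h2⟩ := orderOf_natCard_le hs hsF hd' hq
  have hpos : 0 < orderOf (Nat.card F : ZMod s) := orderOf_pos_iff.2 (isOfFinOrder_iff_isUnit.2 hq.isUnit)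
  rcases Nat.even_or_odd' (orderOf (Nat.card F : ZMod s)) with ⟨k, hk | hk⟩
  · exact ⟨k, by omega, by omega, Or.inr hk.symm,
      exists_orderOf_symplectic_of_orderOf_dvd hs (by omega) (by rw [hk])⟩
  · have hodd : Odd (orderOf (Nat.card F : ZMod s)) := ⟨k, hk⟩
    exact ⟨_, hpos.ne', h2 hodd, Or.inl ⟨rfl, hodd⟩,
      exists_orderOf_symplectic_of_orderOf_dvd hs hpos.ne' (dvd_mul_left _ _)⟩

theorem char_mul_mem_elementOrders {p s m : ℕ} [hp : Fact p.Prime] [CharP F p]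
    (hs : s.Prime) (h : s ≠ p) (hd : s ∣ Nat.card (PSp m F)) (hm : Even m)
    (he : orderOf (Nat.card F : ZMod s) ≠ 2 * m) : p * s ∈ elementOrders (PSp m F) := by
  obtain ⟨k, hk0, hkm, hk, hg⟩ := exists_orderOf_symplectic_of_dvd_natCard hs h hd
  have hlt : k < m := by
    refine lt_of_le_of_ne hkm fun hkm' => ?_
    subst hkm'
    rcases hk with ⟨-, hk⟩ | hk
    · exact (Nat.not_even_iff_odd.2 hk) hm
    · exact he hk.symm
  exact mul_mem_elementOrders_of_add (a := m - k) (b := k) (by omega) hk0 (by omega) hp.out hs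
    h.symm (exists_orderOf_symplectic_eq_char (by omega) p) hg

theorem exists_odd_prime_dvd_sq_add_one {q : ℕ} (hq : 2 ≤ q) :
    ∃ r, r.Prime ∧ r ≠ 2 ∧ r ∣ q ^ 2 + 1 := by
  by_contra! h
  have h2 := Nat.eq_prime_pow_of_unique_prime_dvd (n := q ^ 2 + 1) (p := 2) (by omega)
    fun {d} hd hdvd => by
      by_contra hne
      exact h d hd hne hdvd
  have h4 : ¬ 4 ∣ q ^ 2 + 1 := by
    rw [Nat.dvd_iff_mod_eq_zero, Nat.add_mod, Nat.pow_mod]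
    have := Nat.mod_lt q (show 0 < 4 by norm_num)
    interval_cases q % 4 <;> simp
  apply h4
  rw [h2]
  change 2 ^ 2 ∣ _
  apply pow_dvd_pow
  by_contra! hlt
  have : 2 ^ (q ^ 2 + 1).primeFactorsList.length ≤ 2 ^ 1 :=
    Nat.pow_le_pow_right (by norm_num) (by omega)
  nlinarith

theorem dvd_pow_add_one_of_orderOf_eq {s q m : ℕ} (hs : s.Prime) (hm : m ≠ 0)
    (h : orderOf (q : ZMod s) = 2 * m) : s ∣ q ^ m + 1 := by
  have : Fact s.Prime := ⟨hs⟩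
  rw [← ZMod.natCast_eq_zero_iff]
  have h1 : ((q : ZMod s) ^ m) ^ 2 = 1 := by
    rw [← pow_mul, mul_comm, ← h, pow_orderOf_eq_one]
  rw [pow_two, mul_self_eq_one_iff] at h1
  rcases h1 with h2 | h2
  · have := Nat.le_of_dvd (Nat.pos_of_ne_zero hm) (h ▸ orderOf_dvd_of_pow_eq_one h2)
    omega
  · simp [h2]

theorem mul_mem_elementOrders_of_dvd_pow_add_one {r s m : ℕ} (hm : m ≠ 0) (hr : r.Prime)
    (hs : s.Prime) (hr2 : r ≠ 2) (hs2 : s ≠ 2) (hrs : r ≠ s) (hrd : r ∣ Nat.card F ^ m + 1)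
    (hsd : s ∣ Nat.card F ^ m + 1) : r * s ∈ elementOrders (PSp m F) :=
  mul_mem_elementOrders_of_odd hm hr hs hr2 hs2 (exists_orderOf_symplectic_of_dvd_add_one hm
    (((Nat.coprime_primes hr hs).2 hrs).mul_dvd_of_dvd_of_dvd hrd hsd))

theorem ne_two_of_orderOf_eq {s q m : ℕ} (hm : 2 ≤ m) (h : orderOf (q : ZMod s) = 2 * m) :
    s ≠ 2 := by
  rintro rfl
  have h01 : ∀ a : ZMod 2, a = 0 ∨ a = 1 := by decide
  rcases h01 q with h0 | h0 <;> simp [h0] at h <;> omega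

theorem dvd_natCard_of_mul_mem_elementOrders {G : Type*} [Group G] {r s : ℕ}
    (h : r * s ∈ elementOrders G) : r ∣ Nat.card G := by
  obtain ⟨g, hg⟩ := h
  exact (dvd_mul_right r s).trans (hg ▸ orderOf_dvd_natCard g)

theorem orderOf_eq_of_disjoint {m : ℕ} (hm : 6 ≤ m) (hm4 : m % 4 = 2) {s t : ℕ} (hs : s.Prime)
    (ht : t.Prime) (hne : s ≠ t) (htd : t ∣ Nat.card (PSp m F))
    (hnadj : s * t ∉ elementOrders (PSp m F))
    (hdisj : ∀ r : ℕ, r.Prime → r * s ∈ elementOrders (PSp m F) →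
      r * t ∉ elementOrders (PSp m F))
    (he : orderOf (Nat.card F : ZMod s) = 2 * m) :
    orderOf (Nat.card F : ZMod t) = m - 1 ∨ orderOf (Nat.card F : ZMod t) = 2 * (m - 1) := by
  obtain ⟨p, hpF⟩ := CharP.exists F
  have hp : Fact p.Prime := ⟨CharP.char_is_prime F p⟩
  have hm0 : m ≠ 0 := by omega
  have hsd := dvd_pow_add_one_of_orderOf_eq hs hm0 he
  have hs2 := ne_two_of_orderOf_eq (by omega) he
  obtain ⟨r, hr, hr2, hrd⟩ := exists_odd_prime_dvd_sq_add_one (Finite.one_lt_card (α := F))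
  have hrs : r ≠ s := by
    rintro rfl
    have : orderOf (Nat.card F : ZMod r) ∣ 4 := by
      rw [← ZMod.natCast_eq_zero_iff] at hrd
      push_cast at hrd
      rw [orderOf_dvd_iff_pow_eq_one, show (4 : ℕ) = 2 * 2 from rfl, pow_mul,
        eq_neg_of_add_eq_zero_left hrd]
      simp
    have := Nat.le_of_dvd (by norm_num) this
    omega
  have hrm : r ∣ Nat.card F ^ m + 1 := by
    refine hrd.trans ?_
    have hodd : Odd (m / 2) := Nat.odd_iff.2 (by omega)
    have := hodd.nat_add_dvd_pow_add_pow (Nat.card F ^ 2) 1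
    rwa [one_pow, ← pow_mul, show 2 * (m / 2) = m by omega] at this
  have hrsadj : r * s ∈ elementOrders (PSp m F) :=
    mul_mem_elementOrders_of_dvd_pow_add_one hm0 hr hs hr2 hs2 hrs hrm hsd
  have hnrt := hdisj r hr hrsadj
  have hrt : r ≠ t := by
    rintro rfl
    exact hnadj (mul_comm r s ▸ hrsadj)
  have hrg : ∃ g : symplecticGroup (Fin 2) F, orderOf g = r :=
    exists_orderOf_symplectic_of_dvd_add_one two_ne_zero hrd
  have htp : t ≠ p := by
    rintro rfl
    exact hnrt (mul_mem_elementOrders_of_add (a := 2) (b := m - 2) two_ne_zero (by omega)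
      (by omega) hr ht hrt hrg (exists_orderOf_symplectic_eq_char (by omega) t))
  obtain ⟨k, hk0, hkm, hk, hg⟩ := exists_orderOf_symplectic_of_dvd_natCard ht htp htd
  have hklt : m - 1 ≤ k := by
    by_contra! hlt
    exact hnrt (mul_mem_elementOrders_of_add (a := m - k) (b := k) (by omega) hk0 (by omega)
      hr ht hrt (exists_orderOf_symplectic_mono (by omega) hrg) hg)
  have hkm' : 2 * k = orderOf (Nat.card F : ZMod t) → k ≠ m := by
    rintro h rfl
    exact hnadj (mul_mem_elementOrders_of_dvd_pow_add_one hm0 hs ht hs2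
      (ne_two_of_orderOf_eq (by omega) h.symm) hne hsd (dvd_pow_add_one_of_orderOf_eq ht hm0 h.symm))
  rcases hk with ⟨hk, hodd⟩ | hk
  · left
    have := Nat.odd_iff.1 hodd
    omega
  · right
    have := hkm' hk
    omega

end PrimeGraph


/-- If `S = PSp_{2m}(u)` with `m ≥ 6` even, and `s₁ ≠ s₂` are primes dividing
`|S|` with disjoint neighborhoods in the prime graph of `S`, then (up to
swapping) `ord_{s₁}(u) = 2m`, and if moreover `m ≡ 2 (mod 4)` then
`ord_{s₂}(u) ∈ {m - 1, 2(m - 1)}`. -/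
theorem psp_even_unique_disjoint
    (u : ℕ) (hu : IsPrimePow u)
    (m : ℕ) (hm : 6 ≤ m) (hmeven : Even m)
    (F : Type) [Field F] [Fintype F] (hF : Fintype.card F = u)
    (s1 s2 : ℕ) (hs1 : s1.Prime) (hs2 : s2.Prime) (hne : s1 ≠ s2)
    (hd1 : s1 ∣ Nat.card (PSp m F)) (hd2 : s2 ∣ Nat.card (PSp m F))
    (hnadj : s1 * s2 ∉ elementOrders (PSp m F))
    (hdisj : ¬ ∃ r : ℕ, r.Prime ∧ r ∣ Nat.card (PSp m F) ∧
      r * s1 ∈ elementOrders (PSp m F) ∧ r * s2 ∈ elementOrders (PSp m F)) :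
    (orderOf ((u : ZMod s1)) = 2 * m ∧
      (m % 4 = 2 → orderOf ((u : ZMod s2)) = m - 1 ∨
        orderOf ((u : ZMod s2)) = 2 * (m - 1))) ∨
    (orderOf ((u : ZMod s2)) = 2 * m ∧
      (m % 4 = 2 → orderOf ((u : ZMod s1)) = m - 1 ∨
        orderOf ((u : ZMod s1)) = 2 * (m - 1))) := by
  have hcard : Nat.card F = u := Nat.card_eq_fintype_card.trans hF
  subst hcard
  obtain ⟨p, hpF⟩ := CharP.exists F
  have hp : Fact p.Prime := ⟨CharP.char_is_prime F p⟩
  push Not at hdisj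
  have hdisj12 : ∀ r : ℕ, r.Prime → r * s1 ∈ elementOrders (PSp m F) →
      r * s2 ∉ elementOrders (PSp m F) := fun r hr h1 =>
    hdisj r hr (dvd_natCard_of_mul_mem_elementOrders h1) h1
  by_cases h1 : orderOf (Nat.card F : ZMod s1) = 2 * m
  · exact Or.inl ⟨h1, fun hm4 => orderOf_eq_of_disjoint hm hm4 hs1 hs2 hne hd2 hnadj hdisj12 h1⟩
  by_cases h2 : orderOf (Nat.card F : ZMod s2) = 2 * m
  · exact Or.inr ⟨h2, fun hm4 => orderOf_eq_of_disjoint hm hm4 hs2 hs1 hne.symm hd1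
      (mul_comm s1 s2 ▸ hnadj) (fun r hr h h' => hdisj12 r hr h' h) h2⟩
  exfalso
  rcases eq_or_ne s1 p with rfl | hp1
  · exact hnadj (char_mul_mem_elementOrders hs2 hne.symm hd2 hmeven h2)
  rcases eq_or_ne s2 p with rfl | hp2
  · exact hnadj (mul_comm s1 s2 ▸ char_mul_mem_elementOrders hs1 hne hd1 hmeven h1)
  exact hdisj12 p hp.out (char_mul_mem_elementOrders hs1 hp1 hd1 hmeven h1)
    (char_mul_mem_elementOrders hs2 hp2 hd2 hmeven h2)
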